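/- Let Φ be an m×N complex matrix satisfying the upper restricted isometry inequality ‖Φz‖₂ ≤ √(1+δ_s)·‖z‖₂ for all s-sparse z, with δ_s = δ_s(Φ) ≤ 0.1. Let x ∈ ℂ^N be arbitrary and e ∈ ℂ^m. Then the sample vector u = Φx + e can be written as u = Φx_s + ẽ where ẽ = Φ(x − x_s) + e satisfies ‖ẽ‖₂ ≤ 1.05·(‖x − x_s‖₂ + s^{−1/2}·‖x − x_s‖₁) + ‖e‖₂. -/

import Mathlib

open Matrix
open scoped BigOperators Classical

/-- The Euclidean (ℓ₂) norm of a finitely indexed complex vector. -/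
noncomputable def l2 {ι : Type*} [Fintype ι] (x : ι → ℂ) : ℝ :=
  Real.sqrt (∑ i, ‖x i‖ ^ 2)

/-- The ℓ₁ norm of a finitely indexed complex vector. -/
noncomputable def l1 {ι : Type*} [Fintype ι] (x : ι → ℂ) : ℝ := ∑ i, ‖x i‖

/-- The ℓ∞ (supremum) norm of a finitely indexed complex vector. -/
noncomputable def linf {ι : Type*} [Fintype ι] (x : ι → ℂ) : ℝ := ⨆ i, ‖x i‖

/-- The support of a vector, as a finite set of coordinates. -/
noncomputable def suppF {N : ℕ} (x : Fin N → ℂ) : Finset (Fin N) :=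
  Finset.univ.filter fun i => x i ≠ 0

/-- A vector is `s`-sparse when it has at most `s` nonzero entries. -/
def Sparse {N : ℕ} (s : ℕ) (x : Fin N → ℂ) : Prop := (suppF x).card ≤ s

/-- Restriction of a vector to a set `T` of coordinates: equal to `x` on `T`, zero off `T`. -/
noncomputable def restrictTo {N : ℕ} (x : Fin N → ℂ) (T : Finset (Fin N)) : Fin N → ℂ :=
  fun i => if i ∈ T then x i else 0

/-- `y` is a best `s`-sparse approximation of `x`: it agrees with `x` on a set of `s`
coordinates of largest magnitude and vanishes elsewhere. -/
def IsSparseApprox {N : ℕ} (s : ℕ) (x y : Fin N → ℂ) : Prop :=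
  ∃ T : Finset (Fin N), T.card = min s N ∧ y = restrictTo x T ∧
    ∀ i ∈ T, ∀ j ∉ T, ‖x j‖ ≤ ‖x i‖

/-- The `r`-th restricted isometry constant of `Φ`: the least `δ ≥ 0` such that
`(1-δ)‖x‖² ≤ ‖Φx‖² ≤ (1+δ)‖x‖²` for all `r`-sparse `x`. -/
noncomputable def RIC {m N : ℕ} (Φ : Matrix (Fin m) (Fin N) ℂ) (r : ℕ) : ℝ :=
  sInf {δ : ℝ | 0 ≤ δ ∧ ∀ x : Fin N → ℂ, Sparse r x →
    (1 - δ) * l2 x ^ 2 ≤ l2 (Φ.mulVec x) ^ 2 ∧ l2 (Φ.mulVec x) ^ 2 ≤ (1 + δ) * l2 x ^ 2}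

/-- The column submatrix of `Φ` with columns indexed by the finite set `T`. -/
noncomputable def colSub {m N : ℕ} (Φ : Matrix (Fin m) (Fin N) ℂ) (T : Finset (Fin N)) :
    Matrix (Fin m) {i // i ∈ T} ℂ :=
  Matrix.of fun r c => Φ r c.1

/-- The least-squares estimate `Φ_T† u = (Φ_T* Φ_T)⁻¹ Φ_T* u`, viewed as a vector in `ℂ^N`
supported on `T`. -/
noncomputable def pinvApply {m N : ℕ} (Φ : Matrix (Fin m) (Fin N) ℂ) (T : Finset (Fin N))
    (u : Fin m → ℂ) : Fin N → ℂ :=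
  fun j =>
    if h : j ∈ T then (((colSub Φ T)ᴴ * colSub Φ T)⁻¹ * (colSub Φ T)ᴴ).mulVec u ⟨j, h⟩
    else 0

/-- One iteration of CoSaMP with samples `u` and sparsity level `s`, mapping the current
approximation `a` to the next approximation `a'`. -/
def CoSaMPStep {m N : ℕ} (Φ : Matrix (Fin m) (Fin N) ℂ) (u : Fin m → ℂ) (s : ℕ)
    (a a' : Fin N → ℂ) : Prop :=
  ∃ y2s : Fin N → ℂ,
    IsSparseApprox (2 * s) (Φᴴ.mulVec (u - Φ.mulVec a)) y2s ∧
    IsSparseApprox s (pinvApply Φ (suppF y2s ∪ suppF a) u) a'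

/-- `a` is a sequence of approximations produced by CoSaMP: `a 0 = 0` and each successive
approximation arises from one CoSaMP iteration. -/
def CoSaMPSeq {m N : ℕ} (Φ : Matrix (Fin m) (Fin N) ℂ) (u : Fin m → ℂ) (s : ℕ)
    (a : ℕ → Fin N → ℂ) : Prop :=
  a 0 = 0 ∧ ∀ k, CoSaMPStep Φ u s (a k) (a (k + 1))

/-- The spectral norm (ℓ₂ → ℓ₂ operator norm) of a matrix. -/
noncomputable def specNorm {a b : Type*} [Fintype a] [Fintype b] (M : Matrix a b ℂ) : ℝ :=
  sSup ((fun x => l2 (M.mulVec x)) '' {x | l2 x ≤ 1})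

/-- Every finite set contains, for each admissible size `k`, a subset of `k` elements on which
a given real function is largest. -/
theorem Finset.exists_subset_card_eq_forall_le {ι : Type*} (f : ι → ℝ) (S : Finset ι) (k : ℕ)
    (hk : k ≤ S.card) :
    ∃ T ⊆ S, T.card = k ∧ ∀ i ∈ T, ∀ j ∈ S, j ∉ T → f j ≤ f i := by
  induction k with
  | zero => exact ⟨∅, by simp⟩
  | succ k ih =>
    obtain ⟨T, hTS, hTk, hT⟩ := ih (by omega)
    have hne : (S \ T).Nonempty := by
      rw [← Finset.card_pos, Finset.card_sdiff_of_subset hTS]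
      omega
    obtain ⟨a, ha, hmax⟩ := Finset.exists_max_image (S \ T) f hne
    rw [Finset.mem_sdiff] at ha
    refine ⟨insert a T, Finset.insert_subset ha.1 hTS, ?_, ?_⟩
    · rw [Finset.card_insert_of_notMem ha.2, hTk]
    · intro i hi j hj hjT
      rw [Finset.mem_insert, not_or] at hjT
      rcases Finset.mem_insert.1 hi with rfl | hi
      · exact hmax j (Finset.mem_sdiff.2 ⟨hj, hjT.2⟩)
      · exact hT i hi j hj hjT.2

theorem l2_eq_norm {ι : Type*} [Fintype ι] (x : ι → ℂ) : l2 x = ‖WithLp.toLp 2 x‖ := by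
  rw [EuclideanSpace.norm_eq, l2]

theorem l2_nonneg {ι : Type*} [Fintype ι] (x : ι → ℂ) : 0 ≤ l2 x := Real.sqrt_nonneg _

theorem l2_add_le {ι : Type*} [Fintype ι] (x y : ι → ℂ) : l2 (x + y) ≤ l2 x + l2 y := by
  simpa only [l2_eq_norm, WithLp.toLp_add] using norm_add_le (WithLp.toLp 2 x) (WithLp.toLp 2 y)

theorem l2_restrictTo {N : ℕ} (x : Fin N → ℂ) (T : Finset (Fin N)) :
    l2 (restrictTo x T) = Real.sqrt (∑ i ∈ T, ‖x i‖ ^ 2) := by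
  have h (i : Fin N) : ‖restrictTo x T i‖ ^ 2 = if i ∈ T then ‖x i‖ ^ 2 else 0 := by
    by_cases hi : i ∈ T <;> simp [restrictTo, hi]
  simp [l2, h]

theorem l2_restrictTo_le {N : ℕ} (x : Fin N → ℂ) (T : Finset (Fin N)) :
    l2 (restrictTo x T) ≤ l2 x := by
  rw [l2_restrictTo]
  exact Real.sqrt_le_sqrt (Finset.sum_le_sum_of_subset_of_nonneg (Finset.subset_univ T)
    fun i _ _ => sq_nonneg _)

theorem l2_restrictTo_le_of_norm_le {N s : ℕ} (x : Fin N → ℂ) (T : Finset (Fin N))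
    (hT : T.card ≤ s) {M : ℝ} (hM : 0 ≤ M) (hx : ∀ i, ‖x i‖ ≤ M) :
    l2 (restrictTo x T) ≤ Real.sqrt s * M := by
  rw [l2_restrictTo]
  refine Real.sqrt_le_iff.2 ⟨by positivity, ?_⟩
  rw [mul_pow, Real.sq_sqrt (Nat.cast_nonneg s)]
  calc ∑ i ∈ T, ‖x i‖ ^ 2 ≤ T.card • M ^ 2 :=
        Finset.sum_le_card_nsmul _ _ _ fun i _ => by gcongr; exact hx i
    _ ≤ s * M ^ 2 := by rw [nsmul_eq_mul]; gcongr

theorem sparse_restrictTo {N s : ℕ} (x : Fin N → ℂ) (T : Finset (Fin N)) (hT : T.card ≤ s) :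
    Sparse s (restrictTo x T) := by
  refine (Finset.card_le_card fun i hi => ?_).trans hT
  by_contra h
  simp [suppF, restrictTo, h] at hi

theorem restrictTo_add_restrictTo_compl {N : ℕ} (x : Fin N → ℂ) (T : Finset (Fin N)) :
    restrictTo x T + restrictTo x Tᶜ = x := by
  ext i
  by_cases hi : i ∈ T <;> simp [restrictTo, hi]

theorem l1_eq_sum_add_l1_restrictTo_compl {N : ℕ} (x : Fin N → ℂ) (T : Finset (Fin N)) :
    l1 x = ∑ i ∈ T, ‖x i‖ + l1 (restrictTo x Tᶜ) := by
  have h (i : Fin N) : ‖restrictTo x Tᶜ i‖ = if i ∈ Tᶜ then ‖x i‖ else 0 := by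
    by_cases hi : i ∈ T <;> simp [restrictTo, hi]
  simp only [l1, h, Finset.sum_ite_mem, Finset.univ_inter]
  exact (Finset.sum_add_sum_compl T _).symm

theorem l1_nonneg {ι : Type*} [Fintype ι] (x : ι → ℂ) : 0 ≤ l1 x :=
  Finset.sum_nonneg fun _ _ => norm_nonneg _

/-- If `Φ` expands `s`-sparse vectors by a factor at most `K`, then `‖Φ y‖₂` is controlled by the
largest energy `B` of `y` on `s` coordinates together with its scaled `ℓ₁` norm. -/
theorem l2_mulVec_le_of_block_bound {m N s : ℕ} (hs : 0 < s)
    (Φ : Matrix (Fin m) (Fin N) ℂ) {K : ℝ} (hK : 0 ≤ K)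
    (hΦ : ∀ z : Fin N → ℂ, Sparse s z → l2 (Φ.mulVec z) ≤ K * l2 z) (S : Finset (Fin N)) :
    ∀ (y : Fin N → ℂ) (B : ℝ), (∀ i ∉ S, y i = 0) →
      (∀ T : Finset (Fin N), T.card ≤ s → l2 (restrictTo y T) ≤ B) →
      l2 (Φ.mulVec y) ≤ K * (B + (Real.sqrt s)⁻¹ * l1 y) := by
  have hs' : 0 < Real.sqrt s := Real.sqrt_pos.2 (Nat.cast_pos.2 hs)
  induction S using Finset.strongInduction with
  | H S ih =>
    intro y B hyS hB
    rcases le_or_gt S.card s with hcard | hcard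
    · have hy : restrictTo y S = y := by
        ext i
        by_cases hi : i ∈ S <;> simp [restrictTo, hi, hyS]
      have h1 := hΦ _ (sparse_restrictTo y S hcard)
      have h2 := hB S hcard
      rw [hy] at h1 h2
      have h3 := l1_nonneg y
      refine h1.trans (mul_le_mul_of_nonneg_left (h2.trans ?_) hK)
      exact le_add_of_nonneg_right (by positivity)
    · obtain ⟨T, hTS, hTs, hT⟩ :=
        Finset.exists_subset_card_eq_forall_le (fun i => ‖y i‖) S s hcard.le
      have hTne : T.Nonempty := Finset.card_pos.1 (by omega)
      obtain ⟨a, ha, hmin⟩ := Finset.exists_min_image T (fun i => ‖y i‖) hTne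
      have hrest (i : Fin N) : ‖restrictTo y Tᶜ i‖ ≤ ‖y a‖ := by
        by_cases hiT : i ∈ T
        · simp [restrictTo, hiT]
        · by_cases hiS : i ∈ S
          · simpa [restrictTo, hiT] using hT a ha i hiS hiT
          · simp [restrictTo, hyS i hiS]
      have htail := ih (S \ T) (Finset.sdiff_ssubset hTS hTne) (restrictTo y Tᶜ)
        (Real.sqrt s * ‖y a‖)
        (fun i hi => by
          by_cases hiT : i ∈ T
          · simp [restrictTo, hiT]
          · have hiS : i ∉ S := fun h => hi (Finset.mem_sdiff.2 ⟨h, hiT⟩)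
            simp [restrictTo, hyS i hiS])
        (fun U hU => l2_restrictTo_le_of_norm_le _ U hU (norm_nonneg _) hrest)
      have hhead := (hΦ _ (sparse_restrictTo y T hTs.le)).trans
        (mul_le_mul_of_nonneg_left (hB T hTs.le) hK)
      have hblock : Real.sqrt s * ‖y a‖ ≤ (Real.sqrt s)⁻¹ * ∑ i ∈ T, ‖y i‖ := by
        have h := Finset.card_nsmul_le_sum T (fun i => ‖y i‖) _ hmin
        rw [hTs, nsmul_eq_mul] at h
        rw [le_inv_mul_iff₀ hs', ← mul_assoc, Real.mul_self_sqrt (Nat.cast_nonneg s)]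
        exact h
      calc l2 (Φ.mulVec y)
          = l2 (Φ.mulVec (restrictTo y T) + Φ.mulVec (restrictTo y Tᶜ)) := by
            rw [← Matrix.mulVec_add, restrictTo_add_restrictTo_compl]
        _ ≤ _ := l2_add_le _ _
        _ ≤ K * B + K * (Real.sqrt s * ‖y a‖ + (Real.sqrt s)⁻¹ * l1 (restrictTo y Tᶜ)) :=
            add_le_add hhead htail
        _ ≤ K * B + K * ((Real.sqrt s)⁻¹ * ∑ i ∈ T, ‖y i‖
              + (Real.sqrt s)⁻¹ * l1 (restrictTo y Tᶜ)) := by gcongr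
        _ = K * (B + (Real.sqrt s)⁻¹ * l1 y) := by
            rw [l1_eq_sum_add_l1_restrictTo_compl y T]
            ring

/-- Energy bound: a matrix expanding `s`-sparse vectors by at most `K` satisfies
`‖Φ y‖₂ ≤ K (‖y‖₂ + s^{-1/2} ‖y‖₁)` for every `y`. -/
theorem l2_mulVec_le_of_sparse_bound {m N s : ℕ} (hs : 0 < s)
    (Φ : Matrix (Fin m) (Fin N) ℂ) {K : ℝ} (hK : 0 ≤ K)
    (hΦ : ∀ z : Fin N → ℂ, Sparse s z → l2 (Φ.mulVec z) ≤ K * l2 z) (y : Fin N → ℂ) :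
    l2 (Φ.mulVec y) ≤ K * (l2 y + (Real.sqrt s)⁻¹ * l1 y) :=
  l2_mulVec_le_of_block_bound hs Φ hK hΦ Finset.univ y (l2 y)
    (fun i hi => absurd (Finset.mem_univ i) hi) fun T _ => l2_restrictTo_le y T

/-- **Reduction to the sparse case.**  If `Φ` satisfies the upper restricted isometry
inequality at level `s` with `δ_s ≤ 0.1`, then the samples `u = Φx + e` can be written
as `u = Φx_s + ẽ` with `ẽ = Φ(x − x_s) + e` and
`‖ẽ‖₂ ≤ 1.05(‖x − x_s‖₂ + s^{-1/2}‖x − x_s‖₁) + ‖e‖₂`. -/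
theorem reduction_to_sparse
    {m N : ℕ} (s : ℕ) (hs : 0 < s) (Φ : Matrix (Fin m) (Fin N) ℂ)
    (hupper : ∀ z : Fin N → ℂ, Sparse s z →
      l2 (Φ.mulVec z) ≤ Real.sqrt (1 + RIC Φ s) * l2 z)
    (hδ : RIC Φ s ≤ 0.1)
    (x : Fin N → ℂ) (e : Fin m → ℂ) (xs : Fin N → ℂ) (hxs : IsSparseApprox s x xs) :
    Φ.mulVec x + e = Φ.mulVec xs + (Φ.mulVec (x - xs) + e) ∧
    l2 (Φ.mulVec (x - xs) + e) ≤
      1.05 * (l2 (x - xs) + (Real.sqrt s)⁻¹ * l1 (x - xs)) + l2 e := by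
  refine ⟨by rw [Matrix.mulVec_sub]; abel, (l2_add_le _ _).trans ?_⟩
  have hK : Real.sqrt (1 + RIC Φ s) ≤ 1.05 :=
    Real.sqrt_le_iff.2 ⟨by norm_num, by norm_num at hδ ⊢; linarith⟩
  gcongr
  exact l2_mulVec_le_of_sparse_bound hs Φ (by norm_num)
    (fun z hz => (hupper z hz).trans (mul_le_mul_of_nonneg_right hK (l2_nonneg z))) _
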